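/- Suppose R is Gorenstein with dim_k H(R) ≥ 2, and let Γ be the AR quiver of D^c(R) with AR translation τ. Then: (1) no positive power τ^p of τ has a fixed point in Γ; (2) Γ has no loops. -/

import Mathlib

/-!
# Preamble: an interface for the derived category of DG modules over a cochain DG algebra

We formalize the setting of the paper "Calabi-Yau categories and Poincaré duality spaces".
Let `k` be a field and `R` a DG algebra over `k` with `R^{<0} = 0`, `R^0 = k`, `R^1 = 0`
and `dim_k R < ∞`.  Since the derived category `D(R)` of DG left-`R`-modules (and the derived
category `D(R^o)` of DG right-`R`-modules) is not available in Mathlib, we axiomatize it: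
`C` (resp. `Co`) is a `k`-linear triangulated category playing the role of `D(R)`
(resp. `D(R^o)`), and a `DGSetup` records the distinguished objects (`R`, `k = R/R^{≥1}`,
the dual `D(R) = Hom_k(R,k)`, ...) and operations used in the paper, together with the
standing assumptions of the paper, expressed in terms of cohomology.  Cohomology is
faithfully encoded via `H^i(M) = Hom_{D(R)}(R, Σ^i M)`, so that e.g. the graded algebra
structure of `H(R)` is the (Yoneda) composition product, and `Ext^i_R(M,N) = Hom_{D(R)}(M, Σ^i N)`.
-/

open CategoryTheory CategoryTheory.Limits CategoryTheory.Pretriangulated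

universe v u

section Preamble

variable (k : Type u) [Field k]
variable (C : Type u) [Category.{v} C] [Preadditive C] [HasZeroObject C] [HasShift C ℤ]
  [∀ n : ℤ, (shiftFunctor C n).Additive] [Pretriangulated C]
  [Linear k C] [HasFiniteBiproducts C] [∀ n : ℤ, Functor.Linear k (shiftFunctor C n)]

/-- The objects finitely built from `R₀` using distinguished triangles, (de)suspensions,
(finite) coproducts and direct summands, i.e. the thick subcategory generated by `R₀`.
For `R₀ = R` this is the class of compact objects, i.e. the subcategory `D^c(R)`. -/
inductive FinitelyBuilt (R₀ : C) : C → Prop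
  | base : FinitelyBuilt R₀ R₀
  | iso {M N : C} : (M ≅ N) → FinitelyBuilt R₀ M → FinitelyBuilt R₀ N
  | shift {M : C} (n : ℤ) : FinitelyBuilt R₀ M → FinitelyBuilt R₀ (M⟦n⟧)
  | cone {X Y Z : C} (f : X ⟶ Y) (g : Y ⟶ Z) (h : Z ⟶ X⟦(1 : ℤ)⟧) :
      (Triangle.mk f g h ∈ distTriang C) → FinitelyBuilt R₀ X → FinitelyBuilt R₀ Y →
      FinitelyBuilt R₀ Z
  | retract {M N : C} (i : N ⟶ M) (r : M ⟶ N) : i ≫ r = 𝟙 N →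
      FinitelyBuilt R₀ M → FinitelyBuilt R₀ N

/-- An Auslander-Reiten triangle `X → Y → Z → ΣX` in the full subcategory of a pretriangulated
category determined by the class of objects `P`: a distinguished triangle with nonzero
connecting map, such that every morphism out of `X` (in the subcategory) which is not a split
monomorphism factors through `f`, and every morphism into `Z` which is not a split epimorphism
factors through `g`. -/
structure IsARTriangle (P : Set C) {X Y Z : C} (f : X ⟶ Y) (g : Y ⟶ Z)
    (h : Z ⟶ X⟦(1 : ℤ)⟧) : Prop where
  memX : X ∈ P
  memY : Y ∈ P
  memZ : Z ∈ P
  dist : Triangle.mk f g h ∈ distTriang C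
  h_ne : h ≠ 0
  fac_left : ∀ N' : C, N' ∈ P → ∀ u : X ⟶ N',
      ¬ (∃ r : N' ⟶ X, u ≫ r = 𝟙 X) → ∃ v : Y ⟶ N', f ≫ v = u
  fac_right : ∀ N' : C, N' ∈ P → ∀ v : N' ⟶ Z,
      ¬ (∃ s : Z ⟶ N', s ≫ v = 𝟙 Z) → ∃ u : N' ⟶ Y, u ≫ g = v

/-- The subcategory of objects `P` has right AR triangles: for every object `Z` of `P` with
local endomorphism ring there is an AR triangle ending in `Z`. -/
def HasRightARTriangles (P : Set C) : Prop :=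
  ∀ Z : C, Z ∈ P → IsLocalRing (End Z) →
    ∃ (X Y : C) (f : X ⟶ Y) (g : Y ⟶ Z) (h : Z ⟶ X⟦(1 : ℤ)⟧), IsARTriangle C P f g h

/-- The subcategory of objects `P` has left AR triangles: for every object `X` of `P` with
local endomorphism ring there is an AR triangle starting in `X`. -/
def HasLeftARTriangles (P : Set C) : Prop :=
  ∀ X : C, X ∈ P → IsLocalRing (End X) →
    ∃ (Y Z : C) (f : X ⟶ Y) (g : Y ⟶ Z) (h : Z ⟶ X⟦(1 : ℤ)⟧), IsARTriangle C P f g h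

/-- The subcategory of objects `P` has AR triangles if it has both right and left ones. -/
def HasARTriangles (P : Set C) : Prop :=
  HasRightARTriangles C P ∧ HasLeftARTriangles C P

/-- An object is indecomposable if it is nonzero and in any direct sum decomposition one
of the summands vanishes. -/
def Indec (M : C) : Prop :=
  ¬ IsZero M ∧ ∀ A B : C, Nonempty (M ≅ A ⊞ B) → IsZero A ∨ IsZero B

/-- An irreducible morphism in the full subcategory of objects `P`: a non-isomorphism such
that in any factorization through an object of `P`, the first factor is a split monomorphism
or the second factor is a split epimorphism. -/
def IrredMor (P : Set C) {M N : C} (f : M ⟶ N) : Prop :=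
  ¬ IsIso f ∧ ∀ L : C, L ∈ P → ∀ (σ : M ⟶ L) (ρ : L ⟶ N), σ ≫ ρ = f →
    (∃ s : N ⟶ L, s ≫ ρ = 𝟙 N) ∨ (∃ r : L ⟶ M, σ ≫ r = 𝟙 M)

/-- The indecomposable objects belonging to the class `P`. -/
abbrev IndecObj (P : Set C) : Type _ := {M : C // M ∈ P ∧ Indec C M}

/-- Isomorphism, as an equivalence relation on the indecomposable objects in `P`. -/
def isoSetoid (P : Set C) : Setoid (IndecObj C P) where
  r M N := Nonempty (M.1 ≅ N.1)
  iseqv := ⟨fun M => ⟨Iso.refl M.1⟩, fun ⟨e⟩ => ⟨e.symm⟩, fun ⟨e⟩ ⟨e'⟩ => ⟨e ≪≫ e'⟩⟩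

/-- The vertices of the AR quiver of the full subcategory of objects `P`: isomorphism
classes of indecomposable objects in `P`. -/
def ARVertex (P : Set C) : Type _ := Quotient (isoSetoid C P)

/-- The vertex of the AR quiver given by an indecomposable object. -/
def vertexOf (P : Set C) (M : IndecObj C P) : ARVertex C P :=
  Quotient.mk (isoSetoid C P) M

/-- There is an arrow `[M] → [N]` in the AR quiver iff there is an irreducible morphism
`M → N` between representatives. -/
def VArrow (P : Set C) (v w : ARVertex C P) : Prop :=
  ∃ (M N : IndecObj C P) (f : M.1 ⟶ N.1),
    IrredMor C P f ∧ vertexOf C P M = v ∧ vertexOf C P N = w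

/-- Two vertices of the AR quiver lie in the same component iff they are connected by a
finite zigzag of arrows. -/
def sameComponent (P : Set C) (v w : ARVertex C P) : Prop :=
  Relation.EqvGen (fun v w => VArrow C P v w ∨ VArrow C P w v) v w

/-- The set of components of the AR quiver of the full subcategory of objects `P`. -/
def ARComponents (P : Set C) : Type _ :=
  Quotient (Relation.EqvGen.setoid (fun v w => VArrow C P v w ∨ VArrow C P w v))

/-- The component of the AR quiver containing a given vertex. -/
def componentOf (P : Set C) (v₀ : ARVertex C P) : Set (ARVertex C P) :=
  {v | sameComponent C P v v₀}

/-- An AR translation for the subcategory of objects `P`: the assignment `N ↦ τN` on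
indecomposable objects given by the left hand end terms of AR triangles.  (The end terms
of an AR triangle determine each other up to isomorphism, so `τ` is well defined up to
isomorphism; accordingly any choice satisfies `iso_congr`.) -/
structure ARTranslation (P : Set C) where
  τ : IndecObj C P → IndecObj C P
  triangle : ∀ N : IndecObj C P, ∃ (Y : C) (f : (τ N).1 ⟶ Y) (g : Y ⟶ N.1)
      (h : N.1 ⟶ ((τ N).1)⟦(1 : ℤ)⟧), IsARTriangle C P f g h
  iso_congr : ∀ M N : IndecObj C P, Nonempty (M.1 ≅ N.1) → Nonempty ((τ M).1 ≅ (τ N).1)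

/-- The vertices of the repetitive quiver `ℤA∞`: pairs `(p, n)`, `p ∈ ℤ`, `n ≥ 1`. -/
abbrev ZAVertex : Type := ℤ × ℕ+

/-- The arrows of `ℤA∞`: `(p, n) → (p, n+1)` and `(p, n+1) → (p-1, n)`. -/
def ZAArrow (v w : ZAVertex) : Prop :=
  (w.1 = v.1 ∧ w.2 = v.2 + 1) ∨ (w.1 = v.1 - 1 ∧ v.2 = w.2 + 1)

/-- The translation of the stable translation quiver `ℤA∞`: `τ(p, n) = (p+1, n)`. -/
def ZATrans (v : ZAVertex) : ZAVertex := (v.1 + 1, v.2)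

/-- A set of vertices (a component) of the AR quiver, with translation `τv`, is isomorphic
to `ℤA∞` as a stable translation quiver: it is stable under the translation and there is a
bijection with the vertices of `ℤA∞` matching arrows with arrows and translation with
translation. -/
def IsZAInftyComponent (P : Set C) (τv : ARVertex C P → ARVertex C P)
    (comp : Set (ARVertex C P)) : Prop :=
  ∃ (hτ : ∀ v ∈ comp, τv v ∈ comp) (θ : comp ≃ ZAVertex),
    (∀ v w : comp, VArrow C P v.1 w.1 ↔ ZAArrow (θ v) (θ w)) ∧
    (∀ v : comp, θ ⟨τv v.1, hτ v.1 v.2⟩ = ZATrans (θ v))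

/-- A functor `F` is a Serre functor for the full subcategory of objects `P` of the `k`-linear
category `C`: it preserves `P` and there are isomorphisms
`Hom_k(Hom(M,N), k) ≅ Hom(N, F M)` natural in `M` and `N`. -/
def IsSerreFunctorOn (P : Set C) (F : C ⥤ C) : Prop :=
  (∀ M : C, M ∈ P → F.obj M ∈ P) ∧
  ∃ η : ∀ M N : C, M ∈ P → N ∈ P → Module.Dual k (M ⟶ N) ≃ₗ[k] (N ⟶ F.obj M),
    (∀ (M N N' : C) (hM : M ∈ P) (hN : N ∈ P) (hN' : N' ∈ P) (g : N' ⟶ N)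
        (ψ : Module.Dual k (M ⟶ N)),
        η M N' hM hN' (ψ.comp (Linear.rightComp k M g)) = g ≫ η M N hM hN ψ) ∧
    (∀ (M M' N : C) (hM : M ∈ P) (hM' : M' ∈ P) (hN : N ∈ P) (f : M ⟶ M')
        (ψ : Module.Dual k (M ⟶ N)),
        η M' N hM' hN (ψ.comp (Linear.leftComp k N f)) = η M N hM hN ψ ≫ F.map f)

/-- The `n`-th power of the suspension is a Serre functor for the subcategory of objects `P`. -/
def IsSerreShift (P : Set C) (n : ℤ) : Prop :=
  IsSerreFunctorOn k C P (shiftFunctor C n)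

/-- The full subcategory of objects `P` is an `n`-Calabi-Yau category: `n` is the smallest
non-negative integer such that `Σ^n` is a Serre functor. -/
def IsCalabiYau (P : Set C) (n : ℤ) : Prop :=
  0 ≤ n ∧ IsSerreShift k C P n ∧ ∀ m : ℤ, 0 ≤ m → m < n → ¬ IsSerreShift k C P m

/-- The full subcategory of objects `P` is a Krull-Schmidt category: every object is a finite
direct sum of objects with local endomorphism rings, and such a decomposition is unique up to
isomorphism and permutation of the summands. -/
def KrullSchmidtClass (P : Set C) : Prop :=
  (∀ M : C, M ∈ P → ∃ (n : ℕ) (Ys : Fin n → C),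
      (∀ j, Ys j ∈ P ∧ IsLocalRing (End (Ys j))) ∧ Nonempty (M ≅ ⨁ Ys)) ∧
  (∀ (n m : ℕ) (Ys : Fin n → C) (Zs : Fin m → C),
      (∀ j, IsLocalRing (End (Ys j))) → (∀ j, IsLocalRing (End (Zs j))) →
      Nonempty ((⨁ Ys) ≅ ⨁ Zs) →
      ∃ σ : Fin n ≃ Fin m, ∀ j, Nonempty (Ys j ≅ Zs (σ j)))

/-- Total finite dimensionality of `Ext(M,N) = ⊕_i Hom(M, Σ^i N)` over `k`. -/
def FinTotalExt (M N : C) : Prop :=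
  (∀ i : ℤ, FiniteDimensional k (M ⟶ N⟦i⟧)) ∧
    Set.Finite {i : ℤ | Nontrivial (M ⟶ N⟦i⟧)}

/-- The composition of a chain of morphisms `⋯ → Ms 2 → Ms 1 → Ms 0`. -/
def chainComp (Ms : ℕ → C) (fs : ∀ i, Ms (i + 1) ⟶ Ms i) : ∀ q, Ms q ⟶ Ms 0
  | 0 => 𝟙 (Ms 0)
  | (q + 1) => fs q ≫ chainComp Ms fs q

end Preamble

section Preamble2

variable {C : Type u} [Category.{v} C] [Preadditive C] [HasZeroObject C] [HasShift C ℤ]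
  [∀ n : ℤ, (shiftFunctor C n).Additive] [Pretriangulated C] [HasFiniteBiproducts C]

/-- The action of the AR translation on the vertices of the AR quiver. -/
def ARTranslation.vmap {P : Set C} (t : ARTranslation C P) :
    ARVertex C P → ARVertex C P :=
  Quotient.map t.τ fun M N h => t.iso_congr M N h

end Preamble2
section Setup

variable (k : Type u) [Field k]
variable (C : Type u) [Category.{v} C] [Preadditive C] [HasZeroObject C] [HasShift C ℤ]
  [∀ n : ℤ, (shiftFunctor C n).Additive] [Pretriangulated C]
  [Linear k C] [HasFiniteBiproducts C] [∀ n : ℤ, Functor.Linear k (shiftFunctor C n)]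
variable (Co : Type u) [Category.{v} Co] [Preadditive Co] [HasZeroObject Co] [HasShift Co ℤ]
  [∀ n : ℤ, (shiftFunctor Co n).Additive] [Pretriangulated Co]
  [Linear k Co] [HasFiniteBiproducts Co] [∀ n : ℤ, Functor.Linear k (shiftFunctor Co n)]

/-- The data of the paper's setting.  `C` plays the role of the derived category `D(R)` of DG
left modules over the cochain DG algebra `R` (with `R^{<0} = 0`, `R^0 = k`, `R^1 = 0` and
`dim_k R < ∞`), and `Co` plays the role of the derived category `D(R^o)` of DG right modules.
The fields record the objects and functors used in the paper, and the axioms record the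
standing assumptions, with cohomology encoded as `H^i(M) = Hom_{D(R)}(R, Σ^i M)`. -/
structure DGSetup where
  /-- the free DG module `R` as an object of `D(R)` -/
  R : C
  /-- the free DG module `R` as an object of `D(R^o)` -/
  Ro : Co
  /-- the DG bi-`R`-module `k = R/R^{≥1}` viewed as an object of `D(R)` -/
  kMod : C
  /-- `k = R/R^{≥1}` viewed as an object of `D(R^o)` -/
  kModo : Co
  /-- the dual `D(R) = Hom_k(R,k)` as a DG left module, i.e. as an object of `D(R)` -/
  DR : C
  /-- the dual `D(R) = Hom_k(R,k)` as a DG right module, i.e. as an object of `D(R^o)` -/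
  DRo : Co
  /-- the DG left module `RHom_{R^o}(D(R), R)` -/
  RHomDRR : C
  /-- the functor `D(R) ⊗^L_R - : D(R) → D(R)`, where the tensor product inherits the
  left `R`-structure from the DG bi-`R`-module `D(R)` -/
  tensDR : C ⥤ C
  /-- the functor `Σ RHom_{R^o}(D(R), R) ⊗^L_R - : D(R) → D(R)` -/
  homDR : C ⥤ C
  /-- the cohomology `H^i(M ⊗^L_R N)` of the derived tensor product of a DG right module
  `M` and a DG left module `N` -/
  Htensor : Co → C → ℤ → ModuleCat.{v} k
  /-- the supremum `d = sup { i | H^i(R) ≠ 0 }` -/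
  d : ℤ
  /-- the dimension `dim_k R` of the underlying DG algebra -/
  dimR : ℕ
  /-- `H^i(R) = 0` for `i < 0` -/
  HR_neg : ∀ i : ℤ, i < 0 → Subsingleton (R ⟶ R⟦i⟧)
  /-- `H^0(R) ≅ k` -/
  HR_zero : Nonempty ((R ⟶ R⟦(0 : ℤ)⟧) ≃ₗ[k] k)
  /-- `H^1(R) = 0` -/
  HR_one : Subsingleton (R ⟶ R⟦(1 : ℤ)⟧)
  /-- `dim_k H(R) < ∞`, degreewise finiteness -/
  HR_findim : ∀ i : ℤ, FiniteDimensional k (R ⟶ R⟦i⟧)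
  /-- `dim_k H(R) < ∞`, boundedness -/
  HR_bdd : Set.Finite {i : ℤ | Nontrivial (R ⟶ R⟦i⟧)}
  /-- `H^i(R) = 0` for `i < 0`, in `D(R^o)` -/
  HRo_neg : ∀ i : ℤ, i < 0 → Subsingleton (Ro ⟶ Ro⟦i⟧)
  /-- `H^0(R) ≅ k`, in `D(R^o)` -/
  HRo_zero : Nonempty ((Ro ⟶ Ro⟦(0 : ℤ)⟧) ≃ₗ[k] k)
  /-- `H^1(R) = 0`, in `D(R^o)` -/
  HRo_one : Subsingleton (Ro ⟶ Ro⟦(1 : ℤ)⟧)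
  /-- `dim_k H(R) < ∞`, degreewise finiteness, in `D(R^o)` -/
  HRo_findim : ∀ i : ℤ, FiniteDimensional k (Ro ⟶ Ro⟦i⟧)
  /-- `dim_k H(R) < ∞`, boundedness, in `D(R^o)` -/
  HRo_bdd : Set.Finite {i : ℤ | Nontrivial (Ro ⟶ Ro⟦i⟧)}
  /-- `H^d(R) ≠ 0` -/
  d_mem : Nontrivial (R ⟶ R⟦d⟧)
  /-- `d` bounds the degrees of the nonvanishing cohomology of `R` -/
  d_greatest : ∀ i : ℤ, Nontrivial (R ⟶ R⟦i⟧) → i ≤ d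
  /-- `H^0(k) ≅ k` -/
  Hk_zero : Nonempty ((R ⟶ kMod⟦(0 : ℤ)⟧) ≃ₗ[k] k)
  /-- `H^i(k) = 0` for `i ≠ 0` -/
  Hk_ne : ∀ i : ℤ, i ≠ 0 → Subsingleton (R ⟶ kMod⟦i⟧)
  /-- `H^0(k) ≅ k`, in `D(R^o)` -/
  Hko_zero : Nonempty ((Ro ⟶ kModo⟦(0 : ℤ)⟧) ≃ₗ[k] k)
  /-- `H^i(k) = 0` for `i ≠ 0`, in `D(R^o)` -/
  Hko_ne : ∀ i : ℤ, i ≠ 0 → Subsingleton (Ro ⟶ kModo⟦i⟧)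
  /-- `R ≠ 0`, so `dim_k R ≥ 1` -/
  dimR_pos : 0 < dimR
  /-- `D(R) ⊗^L_R R ≅ D(R)` -/
  tensDR_R : Nonempty (tensDR.obj R ≅ DR)
  /-- `Σ RHom_{R^o}(D(R), R) ⊗^L_R R ≅ Σ RHom_{R^o}(D(R), R)` -/
  homDR_R : Nonempty (homDR.obj R ≅ RHomDRR⟦(1 : ℤ)⟧)
  /-- `H(R ⊗^L_R N) ≅ H(N)` -/
  Htensor_R : ∀ (N : C) (i : ℤ), Nonempty ((Htensor Ro N i : Type v) ≃ₗ[k] (R ⟶ N⟦i⟧))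
  /-- `H(M ⊗^L_R R) ≅ H(M)` -/
  Htensor_Ro : ∀ (M : Co) (i : ℤ), Nonempty ((Htensor M R i : Type v) ≃ₗ[k] (Ro ⟶ M⟦i⟧))

namespace DGSetup

variable {k C Co}
variable (S : DGSetup k C Co)

/-- The cohomology `H^i(M) = Hom_{D(R)}(R, Σ^i M)` of a DG left module, a `k`-vector space. -/
abbrev H (M : C) (i : ℤ) : Type v := S.R ⟶ M⟦i⟧

/-- The cohomology `H^i(M) = Hom_{D(R^o)}(R, Σ^i M)` of a DG right module. -/
abbrev Ho (M : Co) (i : ℤ) : Type v := S.Ro ⟶ M⟦i⟧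

/-- `M` belongs to `D^f(R)`, the full subcategory of DG modules with `dim_k H(M) < ∞`. -/
def memDf (M : C) : Prop :=
  (∀ i : ℤ, FiniteDimensional k (S.H M i)) ∧ Set.Finite {i : ℤ | Nontrivial (S.H M i)}

/-- `M` belongs to `D^f(R^o)`. -/
def memDfo (M : Co) : Prop :=
  (∀ i : ℤ, FiniteDimensional k (S.Ho M i)) ∧ Set.Finite {i : ℤ | Nontrivial (S.Ho M i)}

/-- `M` belongs to `D^c(R)`, the full subcategory of compact objects, i.e. the objects
finitely built from `R`. -/
def memDc (M : C) : Prop := FinitelyBuilt C S.R M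

/-- `M` belongs to `D^c(R^o)`. -/
def memDco (M : Co) : Prop := FinitelyBuilt Co S.Ro M

/-- `D^f(R)` as a class of objects. -/
def Df : Set C := {M | S.memDf M}

/-- `D^c(R)` as a class of objects. -/
def Dc : Set C := {M | S.memDc M}

/-- `D^f(R^o)` as a class of objects. -/
def Dfo : Set Co := {M | S.memDfo M}

/-- `D^c(R^o)` as a class of objects. -/
def Dco : Set Co := {M | S.memDco M}

/-- The total dimension `dim_k H(R)` of the cohomology of `R`. -/
noncomputable def dimH : Cardinal :=
  Cardinal.sum fun i : ℤ => Module.rank k (S.H S.R i)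

/-- The invariant `φ(M) = dim_k Ext_R(M, k)`, with `Ext^i_R(M,k) = Hom_{D(R)}(M, Σ^i k)`. -/
noncomputable def phi (M : C) : Cardinal :=
  Cardinal.sum fun i : ℤ => Module.rank k (M ⟶ S.kMod⟦i⟧)

/-- `R` is a Gorenstein DG algebra: `D(R) ≅ Σ^d R` in `D(R)` and in `D(R^o)`. -/
def Gorenstein : Prop :=
  Nonempty (S.DR ≅ S.R⟦S.d⟧) ∧ Nonempty (S.DRo ≅ S.Ro⟦S.d⟧)

/-- The left action `H^i(R) × H^j(M) → H^{i+j}(M)` of the cohomology algebra of `R` on the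
cohomology of a DG left module, given by (shifted) composition in `D(R)`. -/
noncomputable def hsmul (M : C) {i j : ℤ} (a : S.H S.R i) (x : S.H M j) : S.H M (i + j) :=
  a ≫ (shiftFunctor C i).map x ≫ (shiftFunctorAdd' C j i (i + j) (by omega)).inv.app M

/-- The product on the cohomology algebra `H(R)`, given by composition in `D(R)`. -/
noncomputable def hmul {i j : ℤ} (a : S.H S.R i) (x : S.H S.R j) : S.H S.R (i + j) :=
  S.hsmul S.R a x

/-- Transport of cohomology along an equality of degrees. -/
def hcast (M : C) {i j : ℤ} (h : i = j) : S.H M i →ₗ[k] S.H M j := by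
  subst h; exact LinearMap.id

/-- Right multiplication `x ↦ x · a` on the cohomology algebra, as a linear map. -/
noncomputable def mulRight {m i : ℤ} (a : S.H S.R i) : S.H S.R m →ₗ[k] S.H S.R (m + i) :=
  Linear.rightComp k S.R
    ((shiftFunctor C m).map a ≫ (shiftFunctorAdd' C i m (m + i) (by omega)).inv.app S.R)

/-- Left multiplication `x ↦ a · x` on the cohomology algebra, as a linear map. -/
noncomputable def mulLeft {i m : ℤ} (a : S.H S.R i) : S.H S.R m →ₗ[k] S.H S.R (i + m) :=
  (Linear.rightComp k S.R ((shiftFunctorAdd' C m i (i + m) (by omega)).inv.app S.R)).comp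
    (((Linear.leftComp k ((S.R⟦m⟧)⟦i⟧) a).comp ((shiftFunctor C i).mapLinearMap k)))

/-- There is an isomorphism `D(H(R)) ≅ Σ^n H(R)` of graded left `H(R)`-modules, where
`D(-) = Hom_k(-, k)`: in degree `j` an isomorphism `Hom_k(H^{n-j}(R), k) ≅ H^j(R)`,
compatible with the left action of `H(R)` (the action on the dual being induced by right
multiplication). -/
def dualIsoShiftLeft (n : ℤ) : Prop :=
  ∃ e : ∀ j : ℤ, Module.Dual k (S.H S.R (n - j)) ≃ₗ[k] S.H S.R j,
    ∀ (i j : ℤ) (a : S.H S.R i) (f : Module.Dual k (S.H S.R (n - j))),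
      e (i + j) (f.comp ((S.hcast S.R (show n - (i + j) + i = n - j by omega)).comp
        (S.mulRight a))) = S.hmul a (e j f)

/-- There is an isomorphism `D(H(R)) ≅ Σ^n H(R)` of graded right `H(R)`-modules. -/
def dualIsoShiftRight (n : ℤ) : Prop :=
  ∃ e : ∀ j : ℤ, Module.Dual k (S.H S.R (n - j)) ≃ₗ[k] S.H S.R j,
    ∀ (i j : ℤ) (a : S.H S.R i) (f : Module.Dual k (S.H S.R (n - j))),
      e (j + i) (f.comp ((S.hcast S.R (show i + (n - (j + i)) = n - j by omega)).comp
        (S.mulLeft a))) = S.hmul (e j f) a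

end DGSetup

end Setup

section ShiftHom

variable (k : Type u) [Field k]
variable {C : Type u} [Category.{v} C] [Preadditive C] [HasShift C ℤ]
  [∀ n : ℤ, (shiftFunctor C n).Additive] [Linear k C]
  [∀ n : ℤ, Functor.Linear k (shiftFunctor C n)]

/-- The shift functor as a linear equivalence on morphism spaces. -/
noncomputable def homShiftEquiv (A B : C) (n : ℤ) : (A ⟶ B) ≃ₗ[k] (A⟦n⟧ ⟶ B⟦n⟧) :=
  LinearEquiv.ofBijective ((shiftFunctor C n).mapLinearMap k)
    ⟨(shiftFunctor C n).map_injective, (shiftFunctor C n).map_surjective⟩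

theorem homShiftEquiv_apply {A B : C} (n : ℤ) (f : A ⟶ B) : homShiftEquiv k A B n f = f⟦n⟧' := rfl

/-- `Hom(Σ^a A, B) ≅ Hom(Σ^c A, Σ^b B)` for `c = a + b`. -/
noncomputable def homShiftEquivLeft (A B : C) {a b c : ℤ} (h : a + b = c) :
    (A⟦a⟧ ⟶ B) ≃ₗ[k] (A⟦c⟧ ⟶ B⟦b⟧) :=
  (homShiftEquiv k (A⟦a⟧) B b).trans
    (Linear.homCongr k ((shiftFunctorAdd' C a b c h).app A).symm (Iso.refl _))

/-- `Hom(A, Σ^c B) ≅ Hom(Σ^a A, Σ^b B)` for `b = c + a`. -/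
noncomputable def homShiftEquivRight (A B : C) {a b c : ℤ} (h : c + a = b) :
    (A ⟶ B⟦c⟧) ≃ₗ[k] (A⟦a⟧ ⟶ B⟦b⟧) :=
  (homShiftEquiv k A (B⟦c⟧) a).trans
    (Linear.homCongr k (Iso.refl _) ((shiftFunctorAdd' C c a b h).app B).symm)

theorem homShiftEquivLeft_comp {A B B' : C} {a b c : ℤ} (h : a + b = c)
    (f : A⟦a⟧ ⟶ B) (g : B ⟶ B') :
    homShiftEquivLeft k A B' h (f ≫ g) = homShiftEquivLeft k A B h f ≫ g⟦b⟧' := by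
  simp [homShiftEquivLeft, homShiftEquiv_apply, Linear.homCongr_apply]

end ShiftHom

section Hom

variable {C : Type u} [Category.{v} C]

theorem subsingleton_hom_of_retract_left {M N : C} (i : N ⟶ M) (r : M ⟶ N) (hir : i ≫ r = 𝟙 N)
    (A : C) [Subsingleton (M ⟶ A)] : Subsingleton (N ⟶ A) :=
  ⟨fun u v => by
    rw [← Category.id_comp u, ← Category.id_comp v, ← hir, Category.assoc, Category.assoc,
      Subsingleton.elim (r ≫ u) (r ≫ v)]⟩

theorem subsingleton_hom_of_retract_right {M N : C} (i : N ⟶ M) (r : M ⟶ N) (hir : i ≫ r = 𝟙 N)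
    (A : C) [Subsingleton (A ⟶ M)] : Subsingleton (A ⟶ N) :=
  ⟨fun u v => by
    rw [← Category.comp_id u, ← Category.comp_id v, ← hir, ← Category.assoc, ← Category.assoc,
      Subsingleton.elim (u ≫ i) (v ≫ i)]⟩

variable [Preadditive C]

theorem subsingleton_hom_iff {A B : C} : Subsingleton (A ⟶ B) ↔ ∀ f : A ⟶ B, f = 0 :=
  ⟨fun _ f => Subsingleton.elim f 0, fun h => ⟨fun f g => by rw [h f, h g]⟩⟩

section Linear

variable {k : Type u} [Field k] [Linear k C]

theorem finiteDimensional_hom_of_retract_left {M N : C} (i : N ⟶ M) (r : M ⟶ N)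
    (hir : i ≫ r = 𝟙 N) (A : C) [FiniteDimensional k (M ⟶ A)] : FiniteDimensional k (N ⟶ A) :=
  FiniteDimensional.of_injective (Linear.leftComp k A r) fun u v huv => by
    have : i ≫ r ≫ u = i ≫ r ≫ v := congrArg (i ≫ ·) huv
    simpa [← Category.assoc, hir] using this

theorem finiteDimensional_hom_of_retract_right {M N : C} (i : N ⟶ M) (r : M ⟶ N)
    (hir : i ≫ r = 𝟙 N) (A : C) [FiniteDimensional k (A ⟶ M)] : FiniteDimensional k (A ⟶ N) :=
  FiniteDimensional.of_injective (Linear.rightComp k A i) fun u v huv => by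
    have : (u ≫ i) ≫ r = (v ≫ i) ≫ r := congrArg (· ≫ r) huv
    simpa [hir] using this

end Linear

/-- The morphisms `A ⟶ B` which are sums of morphisms factoring through `X`. -/
def homsThrough (X A B : C) : AddSubgroup (A ⟶ B) :=
  AddSubgroup.closure {φ | ∃ (z : A ⟶ X) (b : X ⟶ B), z ≫ b = φ}

theorem comp_mem_homsThrough {X A : C} (z : A ⟶ X) {B : C} (b : X ⟶ B) :
    z ≫ b ∈ homsThrough X A B :=
  AddSubgroup.subset_closure ⟨z, b, rfl⟩

theorem homsThrough_comp {X A B B' : C} {φ : A ⟶ B} (hφ : φ ∈ homsThrough X A B) (c : B ⟶ B') :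
    φ ≫ c ∈ homsThrough X A B' := by
  induction hφ using AddSubgroup.closure_induction with
  | mem φ hφ =>
    obtain ⟨z, b, rfl⟩ := hφ
    rw [Category.assoc]
    exact comp_mem_homsThrough z (b ≫ c)
  | zero => rw [zero_comp]; exact zero_mem _
  | add φ ψ _ _ hφ hψ => rw [Preadditive.add_comp]; exact add_mem hφ hψ
  | neg φ _ hφ => rw [Preadditive.neg_comp]; exact neg_mem hφ

end Hom

section Triangles

variable {C : Type u} [Category.{v} C] [Preadditive C] [HasZeroObject C] [HasShift C ℤ]
  [∀ n : ℤ, (shiftFunctor C n).Additive] [Pretriangulated C]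

theorem subsingleton_hom_to_obj₃ {X Y Z : C} {f : X ⟶ Y} {g : Y ⟶ Z} {h : Z ⟶ X⟦(1 : ℤ)⟧}
    (hT : Triangle.mk f g h ∈ distTriang C) (A : C) [hY : Subsingleton (A ⟶ Y)]
    [hX : Subsingleton (A ⟶ X⟦(1 : ℤ)⟧)] : Subsingleton (A ⟶ Z) := by
  rw [subsingleton_hom_iff] at hX hY ⊢
  intro u
  obtain ⟨v, rfl⟩ := Triangle.coyoneda_exact₃ _ hT u (hX _)
  exact (congrArg (· ≫ g) (hY v)).trans zero_comp

theorem subsingleton_hom_from_obj₃ {X Y Z : C} {f : X ⟶ Y} {g : Y ⟶ Z} {h : Z ⟶ X⟦(1 : ℤ)⟧}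
    (hT : Triangle.mk f g h ∈ distTriang C) (A : C) [hY : Subsingleton (Y ⟶ A)]
    [hX : Subsingleton (X⟦(1 : ℤ)⟧ ⟶ A)] : Subsingleton (Z ⟶ A) := by
  rw [subsingleton_hom_iff] at hX hY ⊢
  intro u
  obtain ⟨v, rfl⟩ := Triangle.yoneda_exact₃ _ hT u (hY _)
  exact (congrArg (h ≫ ·) (hX v)).trans comp_zero

section Linear

variable {k : Type u} [Field k] [Linear k C]

theorem finiteDimensional_hom_to_obj₃ {X Y Z : C} {f : X ⟶ Y} {g : Y ⟶ Z} {h : Z ⟶ X⟦(1 : ℤ)⟧}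
    (hT : Triangle.mk f g h ∈ distTriang C) (A : C) [FiniteDimensional k (A ⟶ Y)]
    [FiniteDimensional k (A ⟶ X⟦(1 : ℤ)⟧)] : FiniteDimensional k (A ⟶ Z) := by
  have : IsNoetherian k (A ⟶ Z) := by
    refine isNoetherian_of_range_eq_ker (Linear.rightComp k A g) (Linear.rightComp k A h) ?_
    ext u
    constructor
    · rintro ⟨v, rfl⟩
      have h0 : g ≫ h = 0 := comp_distTriang_mor_zero₂₃ _ hT
      simp [h0]
    · intro hu
      obtain ⟨v, hv⟩ := Triangle.coyoneda_exact₃ _ hT u hu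
      exact ⟨v, hv.symm⟩
  infer_instance

theorem finiteDimensional_hom_from_obj₃ {X Y Z : C} {f : X ⟶ Y} {g : Y ⟶ Z}
    {h : Z ⟶ X⟦(1 : ℤ)⟧} (hT : Triangle.mk f g h ∈ distTriang C) (A : C)
    [FiniteDimensional k (Y ⟶ A)] [FiniteDimensional k (X⟦(1 : ℤ)⟧ ⟶ A)] :
    FiniteDimensional k (Z ⟶ A) := by
  have : IsNoetherian k (Z ⟶ A) := by
    refine isNoetherian_of_range_eq_ker (Linear.leftComp k A h) (Linear.leftComp k A g) ?_
    ext u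
    constructor
    · rintro ⟨v, rfl⟩
      have h0 : g ≫ h = 0 := comp_distTriang_mor_zero₂₃ _ hT
      simp [← Category.assoc, h0]
    · intro hu
      obtain ⟨v, hv⟩ := Triangle.yoneda_exact₃ _ hT u hu
      exact ⟨v, hv.symm⟩
  infer_instance

end Linear

end Triangles

section ARTriangles

variable {C : Type u} [Category.{v} C] [Preadditive C] [HasZeroObject C] [HasShift C ℤ]
  [∀ n : ℤ, (shiftFunctor C n).Additive] [Pretriangulated C]

namespace IsARTriangle

variable {P : Set C} {X Y Z : C} {f : X ⟶ Y} {g : Y ⟶ Z} {h : Z ⟶ X⟦(1 : ℤ)⟧}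

theorem comp_right (hT : IsARTriangle C P f g h) : g ≫ h = 0 :=
  comp_distTriang_mor_zero₂₃ _ hT.dist

theorem not_splitEpi (hT : IsARTriangle C P f g h) (s : Z ⟶ Y) : s ≫ g ≠ 𝟙 Z := fun hs =>
  hT.h_ne (by rw [← Category.id_comp h, ← hs, Category.assoc, hT.comp_right, comp_zero])

theorem id_ne_zero (hT : IsARTriangle C P f g h) : 𝟙 Z ≠ 0 := fun h0 =>
  hT.h_ne (by rw [← Category.id_comp h, h0, zero_comp])

/-- Of two endomorphisms adding up to the identity, one is a split epimorphism. -/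
theorem splitEpi_or_of_add_eq_id (hT : IsARTriangle C P f g h) {a b : Z ⟶ Z} (hab : a + b = 𝟙 Z) :
    (∃ s : Z ⟶ Z, s ≫ a = 𝟙 Z) ∨ (∃ s : Z ⟶ Z, s ≫ b = 𝟙 Z) := by
  by_contra! hcon
  obtain ⟨u, hu⟩ := hT.fac_right Z hT.memZ a (not_exists.2 hcon.1)
  obtain ⟨v, hv⟩ := hT.fac_right Z hT.memZ b (not_exists.2 hcon.2)
  exact hT.not_splitEpi (u + v) (by rw [Preadditive.add_comp, hu, hv, hab])

theorem idempotent (hT : IsARTriangle C P f g h) {e : Z ⟶ Z} (he : e ≫ e = e) :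
    e = 0 ∨ e = 𝟙 Z := by
  have key : ∀ e' : Z ⟶ Z, e' ≫ e' = e' → (∃ s : Z ⟶ Z, s ≫ e' = 𝟙 Z) → e' = 𝟙 Z := by
    rintro e' he' ⟨s, hs⟩
    rw [← Category.id_comp e', ← hs, Category.assoc, he']
  rcases hT.splitEpi_or_of_add_eq_id (show e + (𝟙 Z - e) = 𝟙 Z by abel) with hs | hs
  · exact Or.inr (key e he hs)
  · have := key (𝟙 Z - e) (by simp [he]) hs
    exact Or.inl (by simpa using this)

/-- A nonzero retract of the right end term of an AR triangle is isomorphic to it. -/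
theorem nonempty_iso_of_retract (hT : IsARTriangle C P f g h) {M : C} (hM : 𝟙 M ≠ 0)
    (s : M ⟶ Z) (b : Z ⟶ M) (hsb : s ≫ b = 𝟙 M) : Nonempty (Z ≅ M) := by
  have hsb' : ∀ {W : C} (w : M ⟶ W), s ≫ b ≫ w = w := fun w => by
    rw [← Category.assoc, hsb, Category.id_comp]
  rcases hT.idempotent (e := b ≫ s) (by rw [Category.assoc, hsb']) with h0 | h1
  · refine absurd ?_ hM
    rw [← hsb, ← Category.comp_id (s ≫ b), Category.assoc, ← hsb, ← Category.assoc b, h0]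
    simp
  · exact ⟨⟨b, s, h1, hsb⟩⟩

theorem isIso_of_splitEpi (hT : IsARTriangle C P f g h) {φ s : Z ⟶ Z} (hs : s ≫ φ = 𝟙 Z) :
    IsIso φ := by
  have hs' : ∀ {W : C} (w : Z ⟶ W), s ≫ φ ≫ w = w := fun w => by
    rw [← Category.assoc, hs, Category.id_comp]
  rcases hT.idempotent (e := φ ≫ s) (by rw [Category.assoc, hs']) with h0 | h1
  · refine absurd ?_ hT.id_ne_zero
    calc 𝟙 Z = s ≫ (φ ≫ s) ≫ φ := by rw [Category.assoc, hs', hs]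
      _ = 0 := by rw [h0, zero_comp, comp_zero]
  · exact ⟨s, h1, hs⟩

/-- The morphisms in the ideal generated by the left end term of an AR triangle factor through
the middle term within that ideal, if the right end term is not a retract of the left one. -/
theorem exists_lift_mem_homsThrough (hT : IsARTriangle C P f g h)
    (hX : ∀ (b : X ⟶ Z) (s : Z ⟶ X), s ≫ b ≠ 𝟙 Z) {A : C} {φ : A ⟶ Z}
    (hφ : φ ∈ homsThrough X A Z) : ∃ ψ ∈ homsThrough X A Y, ψ ≫ g = φ := by
  induction hφ using AddSubgroup.closure_induction with
  | mem φ hφ =>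
    obtain ⟨z, b, rfl⟩ := hφ
    obtain ⟨b', rfl⟩ := hT.fac_right X hT.memX b (not_exists.2 (hX b))
    exact ⟨z ≫ b', comp_mem_homsThrough z b', Category.assoc _ _ _⟩
  | zero => exact ⟨0, zero_mem _, zero_comp⟩
  | add φ₁ φ₂ _ _ h₁ h₂ =>
    obtain ⟨ψ₁, hψ₁, rfl⟩ := h₁
    obtain ⟨ψ₂, hψ₂, rfl⟩ := h₂
    exact ⟨ψ₁ + ψ₂, add_mem hψ₁ hψ₂, Preadditive.add_comp _ _ _ _ _ _⟩
  | neg φ _ h₁ =>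
    obtain ⟨ψ, hψ, rfl⟩ := h₁
    exact ⟨-ψ, neg_mem hψ, Preadditive.neg_comp _ _⟩

/-- Non-isomorphisms of the right end term of an AR triangle are nilpotent. -/
theorem exists_pow_rightComp_eq_zero (k : Type u) [Field k] [Linear k C]
    (hT : IsARTriangle C P f g h) [FiniteDimensional k (Z ⟶ Z)] {φ : Z ⟶ Z} (hφ : ¬ IsIso φ) :
    ∃ n : ℕ, (Linear.rightComp k Z φ ^ n) (𝟙 Z) = 0 := by
  set L : Module.End k (Z ⟶ Z) := Linear.rightComp k Z φ
  have hL : ∀ (n : ℕ) (x : Z ⟶ Z), (L ^ n) x = x ≫ (L ^ n) (𝟙 Z) := by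
    intro n
    induction n with
    | zero => simp
    | succ n ih =>
      intro x
      rw [pow_succ', Module.End.mul_apply, ih x, Module.End.mul_apply]
      exact Category.assoc _ _ _
  obtain ⟨n, hn⟩ := IsArtinian.monotone_stabilizes L.iterateRange
  have hrange : LinearMap.range (L ^ n) = LinearMap.range (L ^ (n + 1)) := hn (n + 1) n.le_succ
  obtain ⟨r, hr⟩ := hrange.le (LinearMap.mem_range_self (L ^ n) (𝟙 Z))
  refine ⟨n, ?_⟩
  have hr' : (r ≫ φ) ≫ (L ^ n) (𝟙 Z) = (L ^ n) (𝟙 Z) := by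
    rw [← hL, ← hr, pow_succ]
    rfl
  rcases hT.splitEpi_or_of_add_eq_id (show r ≫ φ + (𝟙 Z - r ≫ φ) = 𝟙 Z by abel) with
    ⟨s, hs⟩ | ⟨s, hs⟩
  · exact absurd (hT.isIso_of_splitEpi (s := s ≫ r) (by rw [Category.assoc, hs])) hφ
  · generalize (L ^ n) (𝟙 Z) = p at hr' ⊢
    rw [← Category.id_comp p, ← hs, Category.assoc, Preadditive.sub_comp, hr',
      Category.id_comp, sub_self, comp_zero]

/-- An AR triangle whose right end term is not a retract of the left one gives rise to no
irreducible endomorphism of the right end term. -/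
theorem not_irredMor (k : Type u) [Field k] [Linear k C]
    (hT : IsARTriangle C P f g h) [FiniteDimensional k (Z ⟶ Z)]
    (hX : ∀ (b : X ⟶ Z) (s : Z ⟶ X), s ≫ b ≠ 𝟙 Z) (φ : Z ⟶ Z) : ¬ IrredMor C P φ := by
  rintro ⟨hφ, hirr⟩
  obtain ⟨u, rfl⟩ := hT.fac_right Z hT.memZ φ fun ⟨_, hs⟩ => hφ (hT.isIso_of_splitEpi hs)
  obtain ⟨s, hs⟩ | ⟨r, hr⟩ := hirr Y hT.memY u g rfl
  · exact hT.not_splitEpi s hs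
  have hdescend : ∀ ψ : Z ⟶ Z, ψ ≫ u ≫ g ∈ homsThrough X Z Z → ψ ∈ homsThrough X Z Z := by
    intro ψ hψ
    obtain ⟨ψ', hψ', hψ'g⟩ := hT.exists_lift_mem_homsThrough hX hψ
    obtain ⟨w, hw⟩ := Triangle.coyoneda_exact₂ _ hT.dist (ψ ≫ u - ψ')
      (by change (ψ ≫ u - ψ') ≫ g = 0
          rw [Preadditive.sub_comp, Category.assoc, hψ'g, sub_self])
    have hψu : ψ ≫ u = w ≫ f + ψ' := sub_eq_iff_eq_add.1 hw
    rw [← Category.comp_id ψ, ← hr, ← Category.assoc, hψu]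
    exact homsThrough_comp (add_mem (comp_mem_homsThrough w f) hψ') r
  have hid : 𝟙 Z ∈ homsThrough X Z Z := by
    obtain ⟨n, hn⟩ := hT.exists_pow_rightComp_eq_zero k hφ
    have hmem : (Linear.rightComp k Z (u ≫ g) ^ n) (𝟙 Z) ∈ homsThrough X Z Z := hn ▸ zero_mem _
    clear hn
    induction n with
    | zero => exact hmem
    | succ n ih =>
      rw [pow_succ', Module.End.mul_apply] at hmem
      exact ih (hdescend _ hmem)
  obtain ⟨ψ, -, hψ⟩ := hT.exists_lift_mem_homsThrough hX hid
  exact hT.not_splitEpi ψ hψ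

/-- A nonzero morphism out of the right end term of an AR triangle gives rise to a nonzero
morphism from its target into the suspension of the left end term. -/
theorem exists_ne_zero_to_shift (hT : IsARTriangle C P f g h)
    (hcone : ∀ {W V : C} (a : Z ⟶ W) (b : W ⟶ V) (c : V ⟶ Z⟦(1 : ℤ)⟧),
      Triangle.mk a b c ∈ distTriang C → W ∈ P → V⟦(-1 : ℤ)⟧ ∈ P)
    {W : C} (hW : W ∈ P) {a : Z ⟶ W} (ha : a ≠ 0) : ∃ w : W ⟶ X⟦(1 : ℤ)⟧, w ≠ 0 := by
  obtain ⟨V, b, c, hV⟩ := distinguished_cocone_triangle a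
  have hV' := inv_rot_of_distTriang _ hV
  set T := (Triangle.mk a b c).invRotate
  have h0 : T.mor₁ ≫ a = 0 := comp_distTriang_mor_zero₁₂ _ hV'
  obtain ⟨u, hu⟩ := hT.fac_right _ (hcone a b c hV hW) T.mor₁ fun ⟨s, hs⟩ => ha (by
    rw [← Category.id_comp a]
    exact (congrArg (· ≫ a) hs.symm).trans
      ((Category.assoc _ _ _).trans ((congrArg (s ≫ ·) h0).trans comp_zero)))
  have h1 : T.mor₁ ≫ h = 0 :=
    (congrArg (· ≫ h) hu.symm).trans
      ((Category.assoc _ _ _).trans ((congrArg (u ≫ ·) hT.comp_right).trans comp_zero))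
  obtain ⟨w, hw⟩ := Triangle.yoneda_exact₂ T hV' h h1
  refine ⟨w, fun hw0 => hT.h_ne ?_⟩
  rw [hw]
  exact (congrArg (a ≫ ·) hw0).trans comp_zero

end IsARTriangle

end ARTriangles

namespace FinitelyBuilt

variable {k : Type u} [Field k]
variable {C : Type u} [Category.{v} C] [Preadditive C] [HasZeroObject C] [HasShift C ℤ]
  [∀ n : ℤ, (shiftFunctor C n).Additive] [Pretriangulated C]
  [Linear k C] [∀ n : ℤ, Functor.Linear k (shiftFunctor C n)]
variable {R M N : C}

variable (k) in
/-- Finite dimensionality of `Hom(-, N)` in all degrees propagates from `R` to the objects finitely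
built from it. -/
theorem finiteDimensional_hom_from (hM : FinitelyBuilt C R M)
    (hR : ∀ j : ℤ, FiniteDimensional k (R ⟶ N⟦j⟧)) (j : ℤ) : FiniteDimensional k (M ⟶ N⟦j⟧) := by
  induction hM generalizing j with
  | base => exact hR j
  | iso e _ ih =>
    have := ih j
    exact (Linear.homCongr k e (Iso.refl _)).finiteDimensional
  | shift n _ ih =>
    have := ih (j - n)
    exact (homShiftEquivRight k _ N (sub_add_cancel j n)).finiteDimensional
  | @cone X Y Z f g h hT _ _ ihX ihY =>
    have := ihX (j - 1)
    have := ihY j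
    have : FiniteDimensional k (X⟦(1 : ℤ)⟧ ⟶ N⟦j⟧) :=
      (homShiftEquivRight k X N (sub_add_cancel j 1)).finiteDimensional
    exact finiteDimensional_hom_from_obj₃ hT _
  | retract i r hir _ ih =>
    have := ih j
    exact finiteDimensional_hom_of_retract_left i r hir _

variable (k) in
/-- Finite dimensionality of `Hom(A, -)` in all degrees propagates from `R` to the objects finitely
built from it. -/
theorem finiteDimensional_hom_to {A : C} (hM : FinitelyBuilt C R M)
    (hR : ∀ j : ℤ, FiniteDimensional k (A⟦j⟧ ⟶ R)) (j : ℤ) : FiniteDimensional k (A⟦j⟧ ⟶ M) := by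
  induction hM generalizing j with
  | base => exact hR j
  | iso e _ ih =>
    have := ih j
    exact (Linear.homCongr k (Iso.refl _) e).finiteDimensional
  | shift n _ ih =>
    have := ih (j - n)
    exact (homShiftEquivLeft k A _ (sub_add_cancel j n)).finiteDimensional
  | @cone X Y Z f g h hT _ _ ihX ihY =>
    have := ihX (j - 1)
    have := ihY j
    have : FiniteDimensional k (A⟦j⟧ ⟶ X⟦(1 : ℤ)⟧) :=
      (homShiftEquivLeft k A X (sub_add_cancel j 1)).finiteDimensional
    exact finiteDimensional_hom_to_obj₃ hT _
  | retract i r hir _ ih =>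
    have := ih j
    exact finiteDimensional_hom_of_retract_right i r hir _

variable (k) in
include k in
/-- If `Hom(Σ^j A, R)` vanishes for large `j`, the same holds for the objects finitely built
from `R`. -/
theorem exists_forall_subsingleton_hom_to {A : C} (hM : FinitelyBuilt C R M)
    (hR : ∃ a : ℤ, ∀ j, a ≤ j → Subsingleton (A⟦j⟧ ⟶ R)) :
    ∃ a : ℤ, ∀ j, a ≤ j → Subsingleton (A⟦j⟧ ⟶ M) := by
  induction hM with
  | base => exact hR
  | iso e _ ih =>
    obtain ⟨a, ha⟩ := ih
    refine ⟨a, fun j hj => ?_⟩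
    have := ha j hj
    exact (Linear.homCongr k (Iso.refl _) e).symm.injective.subsingleton
  | shift n _ ih =>
    obtain ⟨a, ha⟩ := ih
    refine ⟨a + n, fun j hj => ?_⟩
    have := ha (j - n) (by omega)
    exact (homShiftEquivLeft k A _ (sub_add_cancel j n)).symm.injective.subsingleton
  | @cone X Y Z f g h hT _ _ ihX ihY =>
    obtain ⟨a, ha⟩ := ihX
    obtain ⟨b, hb⟩ := ihY
    refine ⟨max (a + 1) b, fun j hj => ?_⟩
    have := ha (j - 1) (by omega)
    have := hb j (by omega)
    have : Subsingleton (A⟦j⟧ ⟶ X⟦(1 : ℤ)⟧) :=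
      (homShiftEquivLeft k A X (sub_add_cancel j 1)).symm.injective.subsingleton
    exact subsingleton_hom_to_obj₃ hT _
  | retract i r hir _ ih =>
    obtain ⟨a, ha⟩ := ih
    refine ⟨a, fun j hj => ?_⟩
    have := ha j hj
    exact subsingleton_hom_of_retract_right i r hir _

variable (k) in
include k in
/-- There are no morphisms from an object finitely built from `R` to sufficiently coconnected
objects. -/
theorem exists_subsingleton_hom_of_coconnected (hM : FinitelyBuilt C R M) :
    ∃ a : ℤ, ∀ W : C, (∀ j, a ≤ j → Subsingleton (R⟦j⟧ ⟶ W)) → Subsingleton (M ⟶ W) := by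
  have hshift : ∀ {X : C} (n : ℤ),
      (∃ a : ℤ, ∀ W : C, (∀ j, a ≤ j → Subsingleton (R⟦j⟧ ⟶ W)) → Subsingleton (X ⟶ W)) →
      ∃ a : ℤ, ∀ W : C, (∀ j, a ≤ j → Subsingleton (R⟦j⟧ ⟶ W)) → Subsingleton (X⟦n⟧ ⟶ W) := by
    rintro X n ⟨a, ha⟩
    refine ⟨a + n, fun W hW => ?_⟩
    have := ha (W⟦-n⟧) fun j hj => by
      have := hW (j + n) (by omega)
      exact (homShiftEquivLeft k R W (show j + n + -n = j by omega)).symm.injective.subsingleton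
    have : Subsingleton (X⟦n⟧ ⟶ W⟦(0 : ℤ)⟧) :=
      (homShiftEquivRight k X W (neg_add_cancel n)).symm.injective.subsingleton
    exact (Linear.homCongr k (Iso.refl _)
      ((shiftFunctorZero C ℤ).app W)).symm.injective.subsingleton
  induction hM with
  | base =>
    refine ⟨0, fun W hW => ?_⟩
    have := hW 0 le_rfl
    exact (Linear.homCongr k ((shiftFunctorZero C ℤ).app R)
      (Iso.refl _)).symm.injective.subsingleton
  | iso e _ ih =>
    obtain ⟨a, ha⟩ := ih
    refine ⟨a, fun W hW => ?_⟩
    have := ha W hW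
    exact (Linear.homCongr k e (Iso.refl _)).symm.injective.subsingleton
  | shift n _ ih => exact hshift n ih
  | @cone X Y Z f g h hT _ _ ihX ihY =>
    obtain ⟨a, ha⟩ := hshift 1 ihX
    obtain ⟨b, hb⟩ := ihY
    refine ⟨min a b, fun W hW => ?_⟩
    have := ha W fun j hj => hW j (by omega)
    have := hb W fun j hj => hW j (by omega)
    exact subsingleton_hom_from_obj₃ hT _
  | retract i r hir _ ih =>
    obtain ⟨a, ha⟩ := ih
    refine ⟨a, fun W hW => ?_⟩
    have := ha W hW
    exact subsingleton_hom_of_retract_left i r hir _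

end FinitelyBuilt

namespace DGSetup

set_option linter.unusedSectionVars false

variable {k : Type u} [Field k]
variable {C : Type u} [Category.{v} C] [Preadditive C] [HasZeroObject C] [HasShift C ℤ]
  [∀ n : ℤ, (shiftFunctor C n).Additive] [Pretriangulated C]
  [Linear k C] [HasFiniteBiproducts C] [∀ n : ℤ, Functor.Linear k (shiftFunctor C n)]
variable {Co : Type u} [Category.{v} Co] [Preadditive Co] [HasZeroObject Co] [HasShift Co ℤ]
  [∀ n : ℤ, (shiftFunctor Co n).Additive] [Pretriangulated Co]
  [Linear k Co] [HasFiniteBiproducts Co] [∀ n : ℤ, Functor.Linear k (shiftFunctor Co n)]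
variable (S : DGSetup k C Co)

/-- `Hom(Σ^i R, Σ^j R) ≅ H^{j-i}(R)`. -/
noncomputable def shiftHomEquiv (i j : ℤ) : (S.R ⟶ S.R⟦j - i⟧) ≃ₗ[k] (S.R⟦i⟧ ⟶ S.R⟦j⟧) :=
  homShiftEquivRight k S.R S.R (sub_add_cancel j i)

/-- `Hom(Σ^i R, ΣΣ^j R) ≅ H^{j+1-i}(R)`. -/
noncomputable def shiftHomSuspEquiv (i j : ℤ) :
    (S.R ⟶ S.R⟦j + 1 - i⟧) ≃ₗ[k] (S.R⟦i⟧ ⟶ (S.R⟦j⟧)⟦(1 : ℤ)⟧) :=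
  (S.shiftHomEquiv i (j + 1)).trans
    (Linear.homCongr k (Iso.refl _) ((shiftFunctorAdd' C j 1 (j + 1) rfl).app S.R))

theorem subsingleton_shiftHomSusp {i j : ℤ} (h : Subsingleton (S.R ⟶ S.R⟦j + 1 - i⟧)) :
    Subsingleton (S.R⟦i⟧ ⟶ (S.R⟦j⟧)⟦(1 : ℤ)⟧) :=
  (S.shiftHomSuspEquiv i j).symm.injective.subsingleton

theorem subsingleton_H_of_gt {i : ℤ} (hi : S.d < i) : Subsingleton (S.R ⟶ S.R⟦i⟧) :=
  not_nontrivial_iff_subsingleton.1 fun h => (S.d_greatest i h).not_gt hi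

theorem finiteDimensional_H {M : C} (hM : M ∈ S.Dc) (j : ℤ) :
    FiniteDimensional k (S.R⟦j⟧ ⟶ M) := by
  refine FinitelyBuilt.finiteDimensional_hom_to k hM (fun j => ?_) j
  have := S.HR_findim (0 - j)
  have := (S.shiftHomEquiv j 0).finiteDimensional
  exact (Linear.homCongr k (Iso.refl _) ((shiftFunctorZero C ℤ).app S.R)).finiteDimensional

theorem finiteDimensional_hom {M N : C} (hM : M ∈ S.Dc) (hN : N ∈ S.Dc) :
    FiniteDimensional k (M ⟶ N) := by
  have := FinitelyBuilt.finiteDimensional_hom_from k (N := N) hM (fun j => by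
    have := S.finiteDimensional_H hN (0 - j)
    have : FiniteDimensional k (S.R⟦(0 : ℤ)⟧ ⟶ N⟦j⟧) :=
      (homShiftEquivLeft k S.R N (sub_add_cancel 0 j)).finiteDimensional
    exact (Linear.homCongr k ((shiftFunctorZero C ℤ).app S.R) (Iso.refl _)).finiteDimensional) 0
  exact (Linear.homCongr k (Iso.refl _) ((shiftFunctorZero C ℤ).app N)).finiteDimensional

theorem exists_forall_subsingleton_H {M : C} (hM : M ∈ S.Dc) :
    ∃ a : ℤ, ∀ j, a ≤ j → Subsingleton (S.R⟦j⟧ ⟶ M) := by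
  refine FinitelyBuilt.exists_forall_subsingleton_hom_to k hM ⟨1, fun j hj => ?_⟩
  have := S.HR_neg (0 - j) (by omega)
  have := (S.shiftHomEquiv j 0).symm.injective.subsingleton
  exact (Linear.homCongr k (Iso.refl _)
    ((shiftFunctorZero C ℤ).app S.R)).symm.injective.subsingleton

theorem cone_mem_Dc {X Y Z : C} {f : X ⟶ Y} {g : Y ⟶ Z} {h : Z ⟶ X⟦(1 : ℤ)⟧}
    (hT : Triangle.mk f g h ∈ distTriang C) (hX : X ∈ S.Dc) (hY : Y ∈ S.Dc) : Z ∈ S.Dc :=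
  FinitelyBuilt.cone f g h hT hX hY

theorem shift_R_mem_Dc (n : ℤ) : S.R⟦n⟧ ∈ S.Dc := FinitelyBuilt.shift n FinitelyBuilt.base

/-- Nonzero morphisms out of `Σ^a R` are not killed by nonzero endomorphisms of `Σ^a R`. -/
theorem eq_zero_of_comp_eq_zero {a : ℤ} {Z : C} {x : S.R⟦a⟧ ⟶ Z} (hx : x ≠ 0)
    {c : S.R⟦a⟧ ⟶ S.R⟦a⟧} (hc : c ≫ x = 0) : c = 0 := by
  obtain ⟨e⟩ := S.HR_zero
  have hrank : Module.finrank k (S.R⟦a⟧ ⟶ S.R⟦a⟧) = 1 := by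
    rw [← (e.symm.trans (homShiftEquivRight k S.R S.R (zero_add a))).finrank_eq,
      Module.finrank_self]
  have hid : 𝟙 (S.R⟦a⟧) ≠ 0 := fun h0 => hx (by rw [← Category.id_comp x, h0, zero_comp])
  obtain ⟨l, rfl⟩ := exists_smul_eq_of_finrank_eq_one hrank hid c
  rw [Linear.smul_comp, Category.id_comp] at hc
  rw [(smul_eq_zero.1 hc).resolve_right hx, zero_smul]

/-- The lowest cohomology class of `Z` can be killed without creating lower cohomology. -/
theorem subsingleton_H_cone {a : ℤ} {Z Z' : C} {x : S.R⟦a⟧ ⟶ Z} {p : Z ⟶ Z'}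
    {δ : Z' ⟶ (S.R⟦a⟧)⟦(1 : ℤ)⟧} (hT : Triangle.mk x p δ ∈ distTriang C) (hx : x ≠ 0)
    (hZ : ∀ j, a < j → Subsingleton (S.R⟦j⟧ ⟶ Z)) (j : ℤ) (hj : a < j) :
    Subsingleton (S.R⟦j⟧ ⟶ Z') := by
  have := hZ j hj
  rcases (show a + 1 ≤ j by omega).lt_or_eq with hj' | rfl
  · have := S.subsingleton_shiftHomSusp (S.HR_neg (a + 1 - j) (by omega))
    exact subsingleton_hom_to_obj₃ hT _
  · rw [subsingleton_hom_iff]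
    intro y
    obtain ⟨c, hc⟩ := (homShiftEquivLeft k S.R (S.R⟦a⟧) (show a + 1 = a + 1 from rfl)).surjective
      (y ≫ δ)
    have hcx : c ≫ x = 0 := by
      apply (homShiftEquivLeft k S.R Z (show a + 1 = a + 1 from rfl)).injective
      rw [homShiftEquivLeft_comp, hc, map_zero, Category.assoc]
      have h0 : δ ≫ x⟦(1 : ℤ)⟧' = 0 := comp_distTriang_mor_zero₃₁ _ hT
      rw [h0, comp_zero]
    have hy : y ≫ δ = 0 := by rw [← hc, S.eq_zero_of_comp_eq_zero hx hcx, map_zero]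
    obtain ⟨w, hw⟩ := Triangle.coyoneda_exact₃ _ hT y hy
    rw [hw]
    exact (congrArg (· ≫ p) (Subsingleton.elim (α := S.R⟦a + 1⟧ ⟶ Z) w 0)).trans zero_comp

/-- Killing the lowest cohomology of `Z` by attaching copies of `Σ^a R`. -/
theorem exists_kill_lowest {a : ℤ} {Z : C} (hZc : Z ∈ S.Dc)
    (hZ : ∀ j, a < j → Subsingleton (S.R⟦j⟧ ⟶ Z)) :
    ∃ (Z' : C) (p : Z ⟶ Z'), Z' ∈ S.Dc ∧ (∀ j, a ≤ j → Subsingleton (S.R⟦j⟧ ⟶ Z')) ∧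
      ∀ T : C, Subsingleton (S.R⟦a⟧ ⟶ T) → ∀ u : Z ⟶ T, ∃ v : Z' ⟶ T, u = p ≫ v := by
  induction hn : Module.finrank k (S.R⟦a⟧ ⟶ Z) using Nat.strong_induction_on generalizing Z with
  | _ n ih =>
  subst hn
  have hfd := S.finiteDimensional_H hZc a
  by_cases hsub : Subsingleton (S.R⟦a⟧ ⟶ Z)
  · refine ⟨Z, 𝟙 Z, hZc, fun j hj => ?_, fun T _ u => ⟨u, (Category.id_comp u).symm⟩⟩
    rcases hj.lt_or_eq with hj | rfl
    · exact hZ j hj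
    · exact hsub
  obtain ⟨x, hx⟩ : ∃ x : S.R⟦a⟧ ⟶ Z, x ≠ 0 := by
    rw [subsingleton_hom_iff] at hsub
    push Not at hsub
    exact hsub
  obtain ⟨Z₁, p, δ, hT⟩ := distinguished_cocone_triangle x
  have hlt : Module.finrank k (S.R⟦a⟧ ⟶ Z₁) < Module.finrank k (S.R⟦a⟧ ⟶ Z) := by
    have hsusp : Subsingleton (S.R⟦a⟧ ⟶ (S.R⟦a⟧)⟦(1 : ℤ)⟧) :=
      S.subsingleton_shiftHomSusp (by rw [add_sub_cancel_left]; exact S.HR_one)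
    have hsurj : LinearMap.range (Linear.rightComp k (S.R⟦a⟧) p) = ⊤ := by
      rw [LinearMap.range_eq_top]
      intro y
      obtain ⟨w, hw⟩ := Triangle.coyoneda_exact₃ _ hT y
        (Subsingleton.elim (α := S.R⟦a⟧ ⟶ (S.R⟦a⟧)⟦(1 : ℤ)⟧) _ _)
      exact ⟨w, hw.symm⟩
    have hker : 0 < Module.finrank k (LinearMap.ker (Linear.rightComp k (S.R⟦a⟧) p)) := by
      rw [Module.finrank_pos_iff]
      have h0 : x ≫ p = 0 := comp_distTriang_mor_zero₁₂ _ hT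
      exact ⟨⟨x, h0⟩, 0, fun h => hx (congrArg Subtype.val h)⟩
    have := (Linear.rightComp k (S.R⟦a⟧) p).finrank_range_add_finrank_ker
    rw [hsurj, finrank_top] at this
    omega
  obtain ⟨Z', q, hZ'c, hZ', hfac⟩ := ih _ hlt (S.cone_mem_Dc hT (S.shift_R_mem_Dc a) hZc)
    (S.subsingleton_H_cone hT hx hZ) rfl
  refine ⟨Z', p ≫ q, hZ'c, hZ', fun T hsubT u => ?_⟩
  obtain ⟨v, hv⟩ := Triangle.yoneda_exact₂ _ hT u (Subsingleton.elim (α := S.R⟦a⟧ ⟶ T) _ _)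
  obtain ⟨w, rfl⟩ := hfac T hsubT v
  exact ⟨w, hv.trans (Category.assoc _ _ _).symm⟩

theorem exists_kill_lowest_iterate {a : ℤ} {Z : C} (hZc : Z ∈ S.Dc)
    (hZ : ∀ j, a < j → Subsingleton (S.R⟦j⟧ ⟶ Z)) (n : ℕ) :
    ∃ (Z' : C) (p : Z ⟶ Z'), Z' ∈ S.Dc ∧ (∀ j, a - n < j → Subsingleton (S.R⟦j⟧ ⟶ Z')) ∧
      ∀ T : C, (∀ j, j ≤ a → Subsingleton (S.R⟦j⟧ ⟶ T)) → ∀ u : Z ⟶ T,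
        ∃ v : Z' ⟶ T, u = p ≫ v := by
  induction n with
  | zero => exact ⟨Z, 𝟙 Z, hZc, by simpa using hZ, fun T _ u => ⟨u, (Category.id_comp u).symm⟩⟩
  | succ n ih =>
    obtain ⟨Z₁, p, hZ₁c, hZ₁, hfac₁⟩ := ih
    obtain ⟨Z', q, hZ'c, hZ', hfac⟩ := S.exists_kill_lowest hZ₁c hZ₁
    refine ⟨Z', p ≫ q, hZ'c, fun j hj => hZ' j (by push_cast at hj; omega), fun T hsubT u => ?_⟩
    obtain ⟨v, rfl⟩ := hfac₁ T hsubT u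
    obtain ⟨w, rfl⟩ := hfac T (hsubT _ (by omega)) v
    exact ⟨w, (Category.assoc _ _ _).symm⟩

/-- There are no nonzero morphisms from a compact object `Z` to `T` if the cohomology of `Z` lives
strictly above that of `T`. -/
theorem subsingleton_hom_of_H {a : ℤ} {Z T : C} (hZc : Z ∈ S.Dc)
    (hZ : ∀ j, a < j → Subsingleton (S.R⟦j⟧ ⟶ Z))
    (hsubT : ∀ j, j ≤ a → Subsingleton (S.R⟦j⟧ ⟶ T)) : Subsingleton (Z ⟶ T) := by
  obtain ⟨b, hb⟩ := FinitelyBuilt.exists_subsingleton_hom_of_coconnected k hZc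
  obtain ⟨Z', p, -, hZ', hfac⟩ := S.exists_kill_lowest_iterate hZc hZ (a - b + 1).toNat
  have := hb Z' fun j hj => hZ' j (by omega)
  rw [subsingleton_hom_iff]
  intro u
  obtain ⟨v, rfl⟩ := hfac T hsubT u
  rw [Subsingleton.elim p 0, zero_comp]

/-- A compact object with lowest cohomology in degree `-a` has a nonzero morphism to
`Σ^{a+d} R`. -/
theorem exists_ne_zero_hom_to_shift {a : ℤ} {Z : C} (hZc : Z ∈ S.Dc)
    (hZ : ∀ j, a < j → Subsingleton (S.R⟦j⟧ ⟶ Z)) {x : S.R⟦a⟧ ⟶ Z} (hx : x ≠ 0) :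
    ∃ u : Z ⟶ S.R⟦a + S.d⟧, u ≠ 0 := by
  obtain ⟨y, hy⟩ : ∃ y : S.R⟦a⟧ ⟶ S.R⟦a + S.d⟧, y ≠ 0 := by
    have := S.d_mem
    have : Nontrivial (S.R⟦a⟧ ⟶ S.R⟦a + S.d⟧) :=
      (homShiftEquivRight k S.R S.R (add_comm S.d a)).symm.toEquiv.nontrivial
    exact exists_ne 0
  obtain ⟨Z', p, δ, hT⟩ := distinguished_cocone_triangle x
  have hsub : Subsingleton (Z' ⟶ (S.R⟦a + S.d⟧)⟦(1 : ℤ)⟧) :=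
    S.subsingleton_hom_of_H (S.cone_mem_Dc hT (S.shift_R_mem_Dc a) hZc)
      (S.subsingleton_H_cone hT hx hZ)
      fun j hj => S.subsingleton_shiftHomSusp (S.subsingleton_H_of_gt (by omega))
  obtain ⟨w, hw⟩ : ∃ w : Z⟦(1 : ℤ)⟧ ⟶ (S.R⟦a + S.d⟧)⟦(1 : ℤ)⟧,
      y⟦(1 : ℤ)⟧' = (-x⟦(1 : ℤ)⟧') ≫ w :=
    Triangle.yoneda_exact₃ _ (rot_of_distTriang _ hT) (y⟦(1 : ℤ)⟧')
      (Subsingleton.elim (α := Z' ⟶ (S.R⟦a + S.d⟧)⟦(1 : ℤ)⟧) _ _)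
  obtain ⟨u, rfl⟩ := (shiftFunctor C (1 : ℤ)).map_surjective w
  refine ⟨u, ?_⟩
  rintro rfl
  apply hy
  apply (shiftFunctor C (1 : ℤ)).map_injective
  rw [hw, Functor.map_zero, Functor.map_zero, comp_zero]

theorem exists_H_ne_zero {Z : C} (hZc : Z ∈ S.Dc) (hZ : ¬ IsZero Z) :
    ∃ j : ℤ, ¬ Subsingleton (S.R⟦j⟧ ⟶ Z) := by
  by_contra! hcon
  have : Subsingleton (Z ⟶ Z) := S.subsingleton_hom_of_H (a := 0) hZc (fun j _ => hcon j)
    fun j _ => hcon j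
  exact hZ ((IsZero.iff_id_eq_zero Z).2 (Subsingleton.elim _ _))

/-- The largest `a` with `Hom(Σ^a R, Z) ≠ 0`, for `Z` nonzero and compact: the cohomology of `Z`
starts in degree `-a`. -/
theorem exists_isGreatest {Z : C} (hZc : Z ∈ S.Dc) (hZ : ¬ IsZero Z) :
    ∃ a : ℤ, IsGreatest {j : ℤ | ¬ Subsingleton (S.R⟦j⟧ ⟶ Z)} a := by
  obtain ⟨b, hb⟩ := S.exists_forall_subsingleton_H hZc
  obtain ⟨a, ha, hmax⟩ := Int.exists_greatest_of_bdd (P := fun j => ¬ Subsingleton (S.R⟦j⟧ ⟶ Z))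
    ⟨b, fun j hj => by
      by_contra hlt
      exact hj (hb j (by omega))⟩ (S.exists_H_ne_zero hZc hZ)
  exact ⟨a, ha, hmax⟩

theorem isGreatest_H_of_iso {M N : C} (e : M ≅ N) {a : ℤ}
    (ha : IsGreatest {j : ℤ | ¬ Subsingleton (S.R⟦j⟧ ⟶ M)} a) :
    IsGreatest {j : ℤ | ¬ Subsingleton (S.R⟦j⟧ ⟶ N)} a := by
  convert ha using 4 with j
  exact (Linear.homCongr k (Iso.refl (S.R⟦j⟧)) e.symm).toEquiv.subsingleton_congr

theorem two_le_d (h2 : 2 ≤ S.dimH) : 2 ≤ S.d := by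
  by_contra! hd
  have hle : S.dimH ≤ 1 := by
    have hrank : ∀ i : ℤ, Module.rank k (S.H S.R i) =
        Cardinal.mk (ULift.{v} (PLift (i = 0))) := by
      intro i
      by_cases hi : i = 0
      · subst hi
        obtain ⟨e⟩ := S.HR_zero
        have h1 : Cardinal.lift.{u} (Module.rank k (S.H S.R 0)) = Cardinal.lift.{v} 1 := by
          rw [e.lift_rank_eq, Module.rank_self]
        have h1' : Module.rank k (S.H S.R 0) = 1 := by simpa using h1
        rw [h1', Cardinal.mk_uLift]
        simp
      · have : Subsingleton (S.H S.R i) := by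
          rcases lt_or_ge i 0 with h | h
          · exact S.HR_neg i h
          · rcases eq_or_ne i 1 with rfl | h'
            · exact S.HR_one
            · exact S.subsingleton_H_of_gt (by omega)
        have : IsEmpty (PLift (i = 0)) := ⟨fun h => hi h.down⟩
        rw [rank_subsingleton', Cardinal.mk_eq_zero]
    rw [dimH, funext hrank, ← Cardinal.mk_sigma, Cardinal.le_one_iff_subsingleton]
    refine ⟨?_⟩
    rintro ⟨i, ⟨⟨rfl⟩⟩⟩ ⟨j, ⟨⟨rfl⟩⟩⟩
    rfl
  exact absurd (h2.trans hle) (by norm_num)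

/-- The AR translation strictly lowers the degree in which cohomology starts. -/
theorem lt_of_isARTriangle (hd : 2 ≤ S.d) {X Y Z : C} {f : X ⟶ Y} {g : Y ⟶ Z}
    {h : Z ⟶ X⟦(1 : ℤ)⟧} (hT : IsARTriangle C S.Dc f g h) {a b : ℤ}
    (ha : IsGreatest {j : ℤ | ¬ Subsingleton (S.R⟦j⟧ ⟶ Z)} a)
    (hb : IsGreatest {j : ℤ | ¬ Subsingleton (S.R⟦j⟧ ⟶ X)} b) : a < b := by
  have hZ : ∀ j, a < j → Subsingleton (S.R⟦j⟧ ⟶ Z) := fun j hj => by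
    by_contra hns
    exact (ha.2 hns).not_gt hj
  obtain ⟨x, hx⟩ : ∃ x : S.R⟦a⟧ ⟶ Z, x ≠ 0 := by
    have : ¬ Subsingleton (S.R⟦a⟧ ⟶ Z) := ha.1
    rw [subsingleton_hom_iff] at this
    push Not at this
    exact this
  obtain ⟨u, hu⟩ := S.exists_ne_zero_hom_to_shift hT.memZ hZ hx
  obtain ⟨w, hw⟩ := hT.exists_ne_zero_to_shift
    (fun α β γ hα hW => FinitelyBuilt.shift (-1) (S.cone_mem_Dc hα hT.memZ hW))
    (S.shift_R_mem_Dc _) hu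
  have hmem : ¬ Subsingleton (S.R⟦a + S.d - 1⟧ ⟶ X) := fun _ => hw (by
    have := (homShiftEquivLeft k S.R X (sub_add_cancel (a + S.d) 1)).symm.injective.subsingleton
    exact Subsingleton.elim _ _)
  have := hb.2 hmem
  omega

end DGSetup

section Statements

variable {k : Type u} [Field k]
variable {C : Type u} [Category.{v} C] [Preadditive C] [HasZeroObject C] [HasShift C ℤ]
  [∀ n : ℤ, (shiftFunctor C n).Additive] [Pretriangulated C]
  [Linear k C] [HasFiniteBiproducts C] [∀ n : ℤ, Functor.Linear k (shiftFunctor C n)]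
variable {Co : Type u} [Category.{v} Co] [Preadditive Co] [HasZeroObject Co] [HasShift Co ℤ]
  [∀ n : ℤ, (shiftFunctor Co n).Additive] [Pretriangulated Co]
  [Linear k Co] [HasFiniteBiproducts Co] [∀ n : ℤ, Functor.Linear k (shiftFunctor Co n)]
/-- Suppose `R` is Gorenstein with `dim_k H(R) ≥ 2`.  Then, in the AR quiver
`Γ` of `D^c(R)`: (1) no positive power `τ^p` of the AR translation `τ` has a fixed point
(no indecomposable `M` in `D^c(R)` has `τ^p M ≅ M`); (2) `Γ` has no loops (there is no
irreducible morphism `M → N` between isomorphic indecomposables in `D^c(R)`). -/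
theorem no_tau_fixed_points_no_loops (S : DGSetup k C Co) (hG : S.Gorenstein)
    (h2 : 2 ≤ S.dimH) (t : ARTranslation C S.Dc) :
    (∀ p : ℕ, 0 < p → ∀ M : IndecObj C S.Dc, ¬ Nonempty ((t.τ^[p] M).1 ≅ M.1)) ∧
    (∀ M N : IndecObj C S.Dc, Nonempty (M.1 ≅ N.1) →
      ∀ f : M.1 ⟶ N.1, ¬ IrredMor C S.Dc f) := by
  have hd := S.two_le_d h2
  have hτ : ∀ (p : ℕ) (M : IndecObj C S.Dc) {a b : ℤ},
      IsGreatest {j : ℤ | ¬ Subsingleton (S.R⟦j⟧ ⟶ M.1)} a →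
      IsGreatest {j : ℤ | ¬ Subsingleton (S.R⟦j⟧ ⟶ (t.τ^[p] M).1)} b → a + p ≤ b := by
    intro p M
    induction p with
    | zero =>
      intro a b ha hb
      rw [ha.unique hb, Nat.cast_zero, add_zero]
    | succ p ih =>
      intro a b ha hb
      obtain ⟨c, hc⟩ := S.exists_isGreatest (t.τ^[p] M).2.1 (t.τ^[p] M).2.2.1
      obtain ⟨Y, f, g, h, hT⟩ := t.triangle (t.τ^[p] M)
      rw [Function.iterate_succ_apply'] at hb
      have := ih ha hc
      have := S.lt_of_isARTriangle hd hT hc hb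
      push_cast
      omega
  have hfix : ∀ p : ℕ, 0 < p → ∀ M : IndecObj C S.Dc, ¬ Nonempty ((t.τ^[p] M).1 ≅ M.1) := by
    rintro p hp M ⟨e⟩
    obtain ⟨a, ha⟩ := S.exists_isGreatest M.2.1 M.2.2.1
    have := hτ p M ha (S.isGreatest_H_of_iso e.symm ha)
    omega
  refine ⟨hfix, ?_⟩
  rintro M N ⟨e⟩ f ⟨hf, hirr⟩
  have hloop : IrredMor C S.Dc (e.inv ≫ f) := by
    refine ⟨fun hiso => hf ((isIso_comp_left_iff e.inv f).1 hiso), fun L hL σ ρ hσρ => ?_⟩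
    rcases hirr L hL (e.hom ≫ σ) ρ (by rw [Category.assoc, hσρ, e.hom_inv_id_assoc]) with
      hs | ⟨r, hr⟩
    · exact Or.inl hs
    · refine Or.inr ⟨r ≫ e.hom, ?_⟩
      rw [← cancel_epi e.hom, ← Category.assoc, ← Category.assoc, hr, Category.id_comp,
        Category.comp_id]
  obtain ⟨Y, f', g, h, hT⟩ := t.triangle N
  obtain ⟨Y', f₁, g₁, h₁, hT'⟩ := t.triangle (t.τ N)
  have := S.finiteDimensional_hom N.2.1 N.2.1
  exact hT.not_irredMor k (fun b s hsb => hfix 1 one_pos N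
    (hT'.nonempty_iso_of_retract hT.id_ne_zero s b hsb)) _ hloop

end Statements
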